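/- arXiv:0804.4626 — 2 statements merged into one kernel-verified Lean document; each statement's English description precedes it below -/
import Mathlib

section
/- For a skew diagram A = λ/μ, define Υ(A)_i = max over all partitions α contained in A (as a subdiagram, possibly rotated by 180°) of α_i, and define the base partition B([A])_i = min over all partitions ν with c(λ; μ, ν) ≠ 0 of ν_i. Then Υ(A) = B([A]): the intersection of all partitions ν appearing in the skew character [λ/μ] equals the union partition of all partitions contained in the skew diagram A. -/
/-- `f : ℕ → ℕ` represents a partition (0-indexed parts): weakly decreasing
and eventually zero. -/
def IsPartition (f : ℕ → ℕ) : Prop :=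
  (∀ ⦃i j : ℕ⦄, i ≤ j → f j ≤ f i) ∧ ∃ N, ∀ i, N ≤ i → f i = 0

/-- The box `(i, j)` (row `i`, column `j`, both 0-indexed) lies in the skew
diagram `l / m`. -/
def InSkew (l m : ℕ → ℕ) (p : ℕ × ℕ) : Prop :=
  m p.1 ≤ p.2 ∧ p.2 < l p.1

/-- `T` is a Littlewood–Richardson tableau of skew shape `l / m` and content `n`:
entries are positive exactly on the shape, rows weakly increase, columns strictly
increase, the number of entries equal to `k + 1` is `n k`, and every prefix of the
reverse reading word (right to left, top to bottom) is a lattice word. -/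
structure IsLR (l m n : ℕ → ℕ) (T : ℕ → ℕ → ℕ) : Prop where
  support : ∀ p : ℕ × ℕ, T p.1 p.2 ≠ 0 ↔ InSkew l m p
  row_weak : ∀ i j, InSkew l m (i, j) → InSkew l m (i, j + 1) → T i j ≤ T i (j + 1)
  col_strict : ∀ i j, InSkew l m (i, j) → InSkew l m (i + 1, j) → T i j < T (i + 1) j
  content : ∀ k : ℕ, Nat.card {p : ℕ × ℕ // T p.1 p.2 = k + 1} = n k
  lattice : ∀ i j k : ℕ,
    Nat.card {p : ℕ × ℕ // T p.1 p.2 = k + 2 ∧ (p.1 < i ∨ (p.1 = i ∧ j ≤ p.2))} ≤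
      Nat.card {p : ℕ × ℕ // T p.1 p.2 = k + 1 ∧ (p.1 < i ∨ (p.1 = i ∧ j ≤ p.2))}

/-- The Littlewood–Richardson coefficient `c(l; m, n)`: the number of LR tableaux
of shape `l / m` and content `n`. -/
noncomputable def LR (l m n : ℕ → ℕ) : ℕ :=
  Nat.card {T : ℕ → ℕ → ℕ // IsLR l m n T}

/-- The partition `a` is contained in the skew diagram `l / m`: some translate
of `a`, or of `a` rotated by 180°, is a subset of the diagram. -/
def ContainedIn (a l m : ℕ → ℕ) : Prop :=
  (∃ r c, ∀ i j, j < a i → InSkew l m (r + i, c + j)) ∨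
  (∃ r c, ∀ i j, j < a i → i ≤ r ∧ j ≤ c ∧ InSkew l m (r - i, c - j))

/-- The complement of `f` in the rectangle with `L` rows of length `k`,
rotated by 180°, regarded as a partition. -/
def RotCompl (k L : ℕ) (f : ℕ → ℕ) : ℕ → ℕ :=
  fun i => if i < L then k - f (L - 1 - i) else 0

/-- The tableau with few entries `i + 1`. -/
noncomputable def tabT (l m d : ℕ → ℕ) (i s j : ℕ) : ℕ :=
  if m s ≤ j ∧ j < l s then
    (if Nat.count (fun r => m r ≤ j) s < i then Nat.count (fun r => m r ≤ j) s + 1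
      else i + Nat.count (fun r => l s - j ≤ d r) s + 1)
  else 0

/-- Overlap of rows `s - i, ..., s`. -/
def ovl (l m : ℕ → ℕ) (i s : ℕ) : ℕ := if i ≤ s then l s - m (s - i) else 0

lemma count_exists (P : ℕ → Prop) [DecidablePred P] (v s : ℕ) (h : v < Nat.count P s) :
    ∃ s', s' < s ∧ P s' ∧ Nat.count P s' = v := by
  induction s with
  | zero => simp at h
  | succ s ih =>
    rw [Nat.count_succ] at h
    by_cases hv : v < Nat.count P s
    · obtain ⟨s', h1, h2⟩ := ih hv
      exact ⟨s', by omega, h2⟩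
    · by_cases hP : P s
      · refine ⟨s, by omega, hP, ?_⟩
        simp [hP] at h
        omega
      · simp [hP] at h
        omega

lemma count_fwd (m : ℕ → ℕ) (hm : IsPartition m) (i s j : ℕ) (hs : m s ≤ j)
    (h : i ≤ Nat.count (fun r => m r ≤ j) s) : i ≤ s ∧ m (s - i) ≤ j := by
  have h1 : Nat.count (fun r => m r ≤ j) s ≤ s := Nat.count_le _
  refine ⟨by omega, ?_⟩
  by_contra hc
  have hi : i ≠ 0 := by
    rintro rfl
    exact hc hs
  have e : s = (s - i + 1) + (i - 1) := by omega
  rw [e, Nat.count_add] at h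
  have h2 : Nat.count (fun r => m r ≤ j) (s - i + 1) = 0 := by
    by_contra h0
    obtain ⟨s', h3, h4, -⟩ := count_exists (fun r => m r ≤ j) 0 (s - i + 1) (by omega)
    have := hm.1 (show s' ≤ s - i by omega)
    omega
  have h3 : Nat.count (fun k => m (s - i + 1 + k) ≤ j) (i - 1) ≤ i - 1 := Nat.count_le _
  omega

lemma count_bwd (m : ℕ → ℕ) (hm : IsPartition m) (i s j : ℕ) (hs : i ≤ s)
    (h : m (s - i) ≤ j) : i ≤ Nat.count (fun r => m r ≤ j) s := by
  have e : s = (s - i) + i := by omega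
  rw [e, Nat.count_add]
  have : Nat.count (fun k => m (s - i + k) ≤ j) i = i := by
    rw [Nat.count_iff_forall]
    intro k _
    have := hm.1 (show s - i ≤ s - i + k by omega)
    omega
  omega

lemma fin_supp (l m : ℕ → ℕ) (hl : IsPartition l) (T : ℕ → ℕ → ℕ)
    (hT : ∀ p : ℕ × ℕ, T p.1 p.2 ≠ 0 → InSkew l m p) (P : ℕ × ℕ → Prop)
    (hP : ∀ p, P p → T p.1 p.2 ≠ 0) : {p | P p}.Finite := by
  obtain ⟨N, hN⟩ := hl.2
  apply ((Set.finite_Iio N).prod (Set.finite_Iio (l 0))).subset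
  intro p hp
  have h := hT p (hP p hp)
  refine ⟨?_, ?_⟩
  · by_contra hc
    have := hN p.1 (by simpa using hc)
    have := h.2
    omega
  · have := hl.1 (Nat.zero_le p.1)
    have := h.2
    simp only [Set.mem_Iio]
    omega

lemma card_le_of_rel {α β : Type*} (P : α → Prop) (Q : β → Prop) (hQ : {q | Q q}.Finite)
    (R : α → β → Prop) (hex : ∀ p, P p → ∃ q, Q q ∧ R p q)
    (hinj : ∀ p p' q, P p → P p' → R p q → R p' q → p = p') :
    Nat.card {p // P p} ≤ Nat.card {q // Q q} := by
  by_cases hβ : Nonempty β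
  swap
  · have : IsEmpty {p // P p} := ⟨fun p => hβ ⟨(hex p.1 p.2).choose⟩⟩
    simp
  choose! f hf using hex
  have : Finite {q // Q q} := hQ
  apply Nat.card_le_card_of_injective (fun p : {p // P p} => (⟨f p.1, (hf p.1 p.2).1⟩ : {q // Q q}))
  rintro ⟨p, hp⟩ ⟨p', hp'⟩ h
  simp only [Subtype.mk.injEq] at h
  have h1 := (hf p hp).2
  have h2 := (hf p' hp').2
  rw [h] at h1
  exact Subtype.ext (hinj p p' _ hp hp' h1 h2)

lemma tabT_ne (l m : ℕ → ℕ) (i : ℕ)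
    (s j : ℕ) : tabT l m (ovl l m i) i s j ≠ 0 ↔ (m s ≤ j ∧ j < l s) := by
  unfold tabT
  split_ifs with h1 h2 <;> simp [h1]

lemma tabT_small (l m : ℕ → ℕ) (i : ℕ)
    (s j v : ℕ) (hv : v < i) :
    tabT l m (ovl l m i) i s j = v + 1 ↔
      (m s ≤ j ∧ j < l s ∧ Nat.count (fun r => m r ≤ j) s = v) := by
  unfold tabT
  split_ifs with h1 h2
  · simp [h1]
  · simp only [h1, true_and]
    omega
  · simp only [← and_assoc, h1, false_and]

lemma tabT_big (l m : ℕ → ℕ) (hm : IsPartition m) (i : ℕ)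
    (s j v : ℕ) :
    tabT l m (ovl l m i) i s j = i + v + 1 ↔
      (m s ≤ j ∧ j < l s ∧ l s - j ≤ ovl l m i s ∧
        Nat.count (fun r => l s - j ≤ ovl l m i r) s = v) := by
  unfold tabT
  split_ifs with h1 h2
  · constructor
    · intro h
      omega
    · rintro ⟨h3, h4, h5, h6⟩
      exfalso
      have : i ≤ Nat.count (fun r => m r ≤ j) s := by
        unfold ovl at h5
        split_ifs at h5 with h7
        · exact count_bwd m hm i s j h7 (by omega)
        · omega
      omega
  · have := count_fwd m hm i s j h1.1 (by omega)
    have h3 : l s - j ≤ ovl l m i s := by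
      unfold ovl
      rw [if_pos this.1]
      omega
    simp only [h1, h3, true_and]
    omega
  · simp only [← and_assoc, h1, false_and]

lemma tabT_cases (l m : ℕ → ℕ) (i : ℕ)
    (s j : ℕ) (h : m s ≤ j ∧ j < l s) :
    ∃ v, (v < i ∧ tabT l m (ovl l m i) i s j = v + 1) ∨
      tabT l m (ovl l m i) i s j = i + v + 1 := by
  have h1 := (tabT_ne l m i s j).2 h
  by_cases h2 : tabT l m (ovl l m i) i s j ≤ i
  · exact ⟨tabT l m (ovl l m i) i s j - 1, by omega⟩
  · exact ⟨tabT l m (ovl l m i) i s j - 1 - i, by omega⟩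

lemma tabT_row (l m : ℕ → ℕ) (hl : IsPartition l) (hm : IsPartition m) (i : ℕ)
    (s j : ℕ) (h : m s ≤ j ∧ j < l s) (h' : m s ≤ j + 1 ∧ j + 1 < l s) :
    tabT l m (ovl l m i) i s j ≤ tabT l m (ovl l m i) i s (j + 1) := by
  obtain ⟨v, hv⟩ := tabT_cases l m i s j h
  obtain ⟨v', hv'⟩ := tabT_cases l m i s (j + 1) h'
  rcases hv with ⟨a, hv⟩ | hv <;> rcases hv' with ⟨a', hv'⟩ | hv' <;> rw [hv, hv']
  · rw [tabT_small l m i s _ _ a] at hv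
    rw [tabT_small l m i s _ _ a'] at hv'
    have : Nat.count (fun r => m r ≤ j) s ≤ Nat.count (fun r => m r ≤ j + 1) s :=
      Nat.count_mono_left (fun r hr => by omega)
    omega
  · omega
  · rw [tabT_big l m hm i] at hv
    rw [tabT_small l m i s _ _ a'] at hv'
    have h3 : i ≤ Nat.count (fun r => m r ≤ j + 1) s := by
      have h5 := hv.2.2.1
      unfold ovl at h5
      split_ifs at h5 with h7
      · exact count_bwd m hm i s _ h7 (by omega)
      · omega
    omega
  · rw [tabT_big l m hm i] at hv hv'
    have : Nat.count (fun r => l s - j ≤ ovl l m i r) s ≤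
        Nat.count (fun r => l s - (j + 1) ≤ ovl l m i r) s :=
      Nat.count_mono_left (fun r hr => by omega)
    omega

lemma tabT_col (l m : ℕ → ℕ) (hl : IsPartition l) (hm : IsPartition m) (i : ℕ)
    (s j : ℕ) (h : m s ≤ j ∧ j < l s) (h' : m (s + 1) ≤ j ∧ j < l (s + 1)) :
    tabT l m (ovl l m i) i s j < tabT l m (ovl l m i) i (s + 1) j := by
  obtain ⟨v, hv⟩ := tabT_cases l m i s j h
  obtain ⟨v', hv'⟩ := tabT_cases l m i (s + 1) j h'
  rcases hv with ⟨a, hv⟩ | hv <;> rcases hv' with ⟨a', hv'⟩ | hv' <;> rw [hv, hv']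
  · rw [tabT_small l m i s _ _ a] at hv
    rw [tabT_small l m i _ _ _ a'] at hv'
    have := hv'.2.2
    rw [Nat.count_succ, if_pos h.1] at this
    omega
  · omega
  · rw [tabT_big l m hm i] at hv
    rw [tabT_small l m i _ _ _ a'] at hv'
    have h3 : i ≤ Nat.count (fun r => m r ≤ j) (s + 1) := by
      have h5 := hv.2.2.1
      unfold ovl at h5
      split_ifs at h5 with h7
      · refine count_bwd m hm i (s + 1) _ (by omega) ?_
        have := hm.1 (show s - i ≤ s + 1 - i by omega)
        omega
      · omega
    omega
  · rw [tabT_big l m hm i] at hv hv'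
    have hls := hl.1 (show s ≤ s + 1 by omega)
    have h4 := hv'.2.2.2
    rw [Nat.count_succ, if_pos (by omega)] at h4
    have : Nat.count (fun r => l s - j ≤ ovl l m i r) s ≤
        Nat.count (fun r => l (s + 1) - j ≤ ovl l m i r) s :=
      Nat.count_mono_left (fun r hr => by omega)
    omega

lemma tabT_col_inj (l m : ℕ → ℕ) (hl : IsPartition l) (hm : IsPartition m) (i : ℕ)
    (s s' j : ℕ) (h : m s ≤ j ∧ j < l s) (hs : s < s')
    (h' : m s' ≤ j ∧ j < l s') :
    tabT l m (ovl l m i) i s j < tabT l m (ovl l m i) i s' j := by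
  induction s', hs using Nat.le_induction with
  | base => exact tabT_col l m hl hm i s j h h'
  | succ n hn ih =>
    have h1 := hl.1 (show n ≤ n + 1 by omega)
    have h2 := hm.1 (show s ≤ n by omega)
    have h3 : m n ≤ j ∧ j < l n := by omega
    exact (ih h3).trans (tabT_col l m hl hm i n j h3 h')

lemma tabT_col_eq (l m : ℕ → ℕ) (hl : IsPartition l) (hm : IsPartition m) (i : ℕ)
    (s s' j : ℕ) (h0 : tabT l m (ovl l m i) i s j ≠ 0)
    (h : tabT l m (ovl l m i) i s j = tabT l m (ovl l m i) i s' j) : s = s' := by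
  have h1 := (tabT_ne l m i s j).1 h0
  have h2 := (tabT_ne l m i s' j).1 (h ▸ h0)
  rcases lt_trichotomy s s' with hs | hs | hs
  · have := tabT_col_inj l m hl hm i s s' j h1 hs h2
    omega
  · exact hs
  · have := tabT_col_inj l m hl hm i s' s j h2 hs h1
    omega

lemma tabT_lattice (l m : ℕ → ℕ) (hl : IsPartition l) (hm : IsPartition m) (i : ℕ)
    (a b k : ℕ) :
    Nat.card {p : ℕ × ℕ // tabT l m (ovl l m i) i p.1 p.2 = k + 2 ∧
        (p.1 < a ∨ (p.1 = a ∧ b ≤ p.2))} ≤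
      Nat.card {p : ℕ × ℕ // tabT l m (ovl l m i) i p.1 p.2 = k + 1 ∧
        (p.1 < a ∨ (p.1 = a ∧ b ≤ p.2))} := by
  have hfin := fin_supp l m hl (tabT l m (ovl l m i) i)
      (fun p hp => (tabT_ne l m i p.1 p.2).1 hp)
      (fun p => tabT l m (ovl l m i) i p.1 p.2 = k + 1 ∧
        (p.1 < a ∨ (p.1 = a ∧ b ≤ p.2))) (by rintro p ⟨h, -⟩; omega)
  by_cases hk : k < i
  · apply card_le_of_rel _ _ hfin (fun p q => p.2 = q.2)
    · rintro ⟨s, j⟩ ⟨h1, h2⟩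
      dsimp only at h1 h2
      have h3 : m s ≤ j ∧ j < l s := (tabT_ne l m i s j).1 (by omega)
      have h4 : k < Nat.count (fun r => m r ≤ j) s := by
        by_cases hk' : k + 1 < i
        · rw [tabT_small l m i s j (k + 1) hk'] at h1
          omega
        · have e : k + 2 = i + 0 + 1 := by omega
          rw [e] at h1
          replace h1 := (tabT_big l m hm i s j 0).1 h1
          have h5 := h1.2.2.1
          unfold ovl at h5
          split_ifs at h5 with h7
          · have := count_bwd m hm i s _ h7 (show m (s - i) ≤ j by omega)
            omega
          · omega
      obtain ⟨s', hs', h5, h6⟩ := count_exists _ _ _ h4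
      refine ⟨(s', j), ⟨?_, ?_⟩, rfl⟩
      · dsimp only
        rw [tabT_small l m i s' j k hk]
        have := hl.1 hs'.le
        exact ⟨h5, by omega, h6⟩
      · left
        dsimp only
        omega
    · rintro ⟨s, j⟩ ⟨s', j'⟩ ⟨q, q'⟩ ⟨h1, -⟩ ⟨h2, -⟩ h3 h4
      dsimp only at *
      obtain rfl : j = j' := by omega
      rw [tabT_col_eq l m hl hm i s s' j (by omega) (by omega)]
  · obtain ⟨v, rfl⟩ : ∃ v, k = i + v := ⟨k - i, by omega⟩
    apply card_le_of_rel _ _ hfin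
      (fun p q => (l p.1 : ℤ) - p.2 = (l q.1 : ℤ) - q.2)
    · rintro ⟨s, j⟩ ⟨h1, h2⟩
      dsimp only at h1 h2
      have e : i + v + 2 = i + (v + 1) + 1 := by omega
      rw [e, tabT_big l m hm i] at h1
      obtain ⟨h3, h4, h5, h6⟩ := h1
      obtain ⟨s', hs', h7, h8⟩ := count_exists _ v s (by rw [h6]; omega)
      have h9 : ovl l m i s' ≤ l s' - m s' := by
        unfold ovl
        split_ifs
        · have := hm.1 (show s' - i ≤ s' by omega)
          omega
        · omega
      have h10 := hl.1 hs'.le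
      have h11 : l s' - (l s' - (l s - j)) = l s - j := by omega
      refine ⟨(s', l s' - (l s - j)), ⟨?_, ?_⟩, ?_⟩
      · dsimp only
        rw [tabT_big l m hm i, h11]
        exact ⟨by omega, by omega, h7, h8⟩
      · left
        dsimp only
        omega
      · dsimp only
        omega
    · rintro ⟨s, j⟩ ⟨s', j'⟩ ⟨q, q'⟩ ⟨h1, -⟩ ⟨h2, -⟩ h3 h4
      dsimp only at *
      have e : i + v + 2 = i + (v + 1) + 1 := by omega
      rw [e, tabT_big l m hm i] at h1 h2
      have e2 : l s - j = l s' - j' := by omega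
      rw [← e2] at h2
      have : s = s' := Nat.count_injective (p := fun r => l s - j ≤ ovl l m i r)
        h1.2.2.1 h2.2.2.1 (h1.2.2.2.trans h2.2.2.2.symm)
      subst this
      have : j = j' := by omega
      rw [this]

lemma tabT_content_le (l m : ℕ → ℕ) (hl : IsPartition l) (hm : IsPartition m) (i : ℕ)
    (w : ℕ) (hw : ∀ s, ovl l m i s ≤ w) :
    Nat.card {p : ℕ × ℕ // tabT l m (ovl l m i) i p.1 p.2 = i + 1} ≤ w := by
  have : Nat.card {q : ℕ // 1 ≤ q ∧ q ≤ w} = w := by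
    have h : Nat.card (Set.Icc 1 w) = w := by
      rw [Nat.card_eq_card_toFinset]
      simp
    exact h
  rw [← this]
  apply card_le_of_rel _ _ (Set.finite_Icc 1 w) (fun p q => l p.1 - p.2 = q)
  · rintro ⟨s, j⟩ h1
    have h2 := (tabT_big l m hm i s j 0).1 h1
    have := hw s
    exact ⟨_, ⟨by dsimp only; omega, by dsimp only; omega⟩, rfl⟩
  · rintro ⟨s, j⟩ ⟨s', j'⟩ q h1 h2 h3 h4
    dsimp only at *
    have h1 := (tabT_big l m hm i s j 0).1 h1
    have h2 := (tabT_big l m hm i s' j' 0).1 h2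
    have e2 : l s - j = l s' - j' := by omega
    rw [← e2] at h2
    have : s = s' := Nat.count_injective (p := fun r => l s - j ≤ ovl l m i r)
      h1.2.2.1 h2.2.2.1 (h1.2.2.2.trans h2.2.2.2.symm)
    subst this
    have : j = j' := by omega
    rw [this]


lemma isLR_finite (l m n : ℕ → ℕ) (hl : IsPartition l) (hn : IsPartition n) :
    Finite {T : ℕ → ℕ → ℕ // IsLR l m n T} := by
  obtain ⟨N, hN⟩ := hl.2
  obtain ⟨K, hK⟩ := hn.2
  have bd : ∀ T, IsLR l m n T → ∀ s j, T s j < K + 1 := by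
    intro T hT s j
    by_contra hc
    obtain ⟨k, hk⟩ : ∃ k, T s j = k + 1 := ⟨T s j - 1, by omega⟩
    have h1 := hT.content k
    rw [hK k (by omega)] at h1
    have hf : Finite {p : ℕ × ℕ // T p.1 p.2 = k + 1} :=
      fin_supp l m hl T (fun p hp => (hT.support p).1 hp) _ (by intro p hp; omega)
    rw [Finite.card_eq_zero_iff] at h1
    exact h1.elim ⟨(s, j), hk⟩
  apply Finite.of_injective (fun T : {T : ℕ → ℕ → ℕ // IsLR l m n T} =>
    fun (a : Fin N) (b : Fin (l 0)) => (⟨T.1 a b, bd T.1 T.2 a b⟩ : Fin (K + 1)))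
  rintro ⟨T, hT⟩ ⟨T', hT'⟩ h
  apply Subtype.ext
  funext s j
  dsimp only
  by_cases hc : InSkew l m (s, j)
  · have h1 : s < N := by
      by_contra h1
      have := hN s (by omega)
      have := hc.2
      dsimp only at this
      omega
    have h2 : j < l 0 := by
      have := hl.1 (Nat.zero_le s)
      have := hc.2
      dsimp only at this
      omega
    have := congrFun (congrFun h ⟨s, h1⟩) ⟨j, h2⟩
    simpa using this
  · have h1 : T s j = 0 := by
      by_contra h0
      exact hc ((hT.support (s, j)).1 h0)
    have h2 : T' s j = 0 := by
      by_contra h0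
      exact hc ((hT'.support (s, j)).1 h0)
    rw [h1, h2]

lemma exists_small (l m : ℕ → ℕ) (hl : IsPartition l) (hm : IsPartition m) (i w : ℕ)
    (hw : ∀ s, ovl l m i s ≤ w) : ∃ n, IsPartition n ∧ LR l m n ≠ 0 ∧ n i ≤ w := by
  obtain ⟨N, hN⟩ := hl.2
  have hb : ∀ s j, tabT l m (ovl l m i) i s j ≠ 0 → s < N := by
    intro s j h
    rw [tabT_ne] at h
    by_contra h1
    have := hN s (by omega)
    omega
  let n : ℕ → ℕ := fun k => Nat.card {p : ℕ × ℕ // tabT l m (ovl l m i) i p.1 p.2 = k + 1}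
  have hpre : ∀ k, Nat.card {p : ℕ × ℕ // tabT l m (ovl l m i) i p.1 p.2 = k + 1 ∧
        (p.1 < N ∨ (p.1 = N ∧ 0 ≤ p.2))} = n k := by
    intro k
    apply Nat.card_congr
    apply Equiv.subtypeEquivRight
    rintro ⟨s, j⟩
    constructor
    · exact fun h => h.1
    · intro h
      exact ⟨h, Or.inl (hb s j (by dsimp only at h; omega))⟩
  have hn : IsPartition n := by
    constructor
    · have : Antitone n := by
        apply antitone_nat_of_succ_le
        intro k
        rw [← hpre k, ← hpre (k + 1)]
        exact tabT_lattice l m hl hm i N 0 k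
      exact this
    · refine ⟨i + N + 1, fun k hk => ?_⟩
      have : IsEmpty {p : ℕ × ℕ // tabT l m (ovl l m i) i p.1 p.2 = k + 1} := by
        constructor
        rintro ⟨⟨s, j⟩, h⟩
        dsimp only at h
        have h1 := hb s j (by omega)
        obtain ⟨v, rfl⟩ : ∃ v, k = i + v := ⟨k - i, by omega⟩
        have h2 := ((tabT_big l m hm i s j v).1 h).2.2.2
        have h3 : Nat.count (fun r => l s - j ≤ ovl l m i r) s ≤ s := Nat.count_le _
        omega
      exact Nat.card_of_isEmpty
  have hLR : IsLR l m n (tabT l m (ovl l m i) i) :=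
    { support := fun p => tabT_ne l m i p.1 p.2
      row_weak := fun s j h h' => tabT_row l m hl hm i s j h h'
      col_strict := fun s j h h' => tabT_col l m hl hm i s j h h'
      content := fun k => rfl
      lattice := fun a b k => tabT_lattice l m hl hm i a b k }
  refine ⟨n, hn, ?_, tabT_content_le l m hl hm i w hw⟩
  have := isLR_finite l m n hl hn
  have : Nonempty {T : ℕ → ℕ → ℕ // IsLR l m n T} := ⟨⟨_, hLR⟩⟩
  exact Nat.card_pos.ne'

lemma lr_row (l m n : ℕ → ℕ) (T : ℕ → ℕ → ℕ)
    (hT : IsLR l m n T)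
    (s j j' : ℕ) (h : j ≤ j') (h1 : InSkew l m (s, j)) (h2 : InSkew l m (s, j')) :
    T s j ≤ T s j' := by
  induction j', h using Nat.le_induction with
  | base => exact le_rfl
  | succ k hk ih =>
    have h3 : InSkew l m (s, k) := by
      have a := h1.1
      have b := h2.2
      exact ⟨by dsimp only at *; omega, by dsimp only at *; omega⟩
    exact (ih h3).trans (hT.row_weak s k h3 h2)

lemma lr_step (l m n : ℕ → ℕ) (hl : IsPartition l) (T : ℕ → ℕ → ℕ)
    (hT : IsLR l m n T)
    (s k : ℕ) :
    Nat.card {p : ℕ × ℕ // T p.1 p.2 = k + 2 ∧ p.1 ≤ s} ≤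
      Nat.card {p : ℕ × ℕ // T p.1 p.2 = k + 1 ∧ p.1 < s} := by
  obtain ⟨j0, h0, h1⟩ : ∃ j0, (∀ j, k + 2 ≤ T s j → j0 ≤ j) ∧
      (∀ j, j0 ≤ j → T s j ≠ k + 1) := by
    by_cases hex : ∃ j, k + 2 ≤ T s j
    · classical
      refine ⟨Nat.find hex, fun j hj => Nat.find_min' hex hj, fun j hj hc => ?_⟩
      have h2 := Nat.find_spec hex
      have := lr_row l m n T hT s _ j hj ((hT.support (s, _)).1 (by dsimp only; omega))
        ((hT.support (s, j)).1 (by dsimp only; omega))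
      omega
    · refine ⟨l s, fun j hj => (hex ⟨j, hj⟩).elim, fun j hj hc => ?_⟩
      have := ((hT.support (s, j)).1 (by dsimp only; omega)).2
      dsimp only at this
      omega
  have hlat := hT.lattice s j0 k
  calc _ = _ := ?_
    _ ≤ _ := hlat
    _ = _ := ?_
  · apply Nat.card_congr
    apply Equiv.subtypeEquivRight
    rintro ⟨a, b⟩
    dsimp only
    constructor
    · rintro ⟨h2, h3⟩
      refine ⟨h2, ?_⟩
      rcases h3.lt_or_eq with h | h
      · exact Or.inl h
      · subst h
        exact Or.inr ⟨rfl, h0 b (by omega)⟩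
    · rintro ⟨h2, h3⟩
      exact ⟨h2, by omega⟩
  · apply Nat.card_congr
    apply Equiv.subtypeEquivRight
    rintro ⟨a, b⟩
    dsimp only
    constructor
    · rintro ⟨h2, h3⟩
      refine ⟨h2, ?_⟩
      rcases h3 with h | ⟨rfl, h⟩
      · exact h
      · exact (h1 b h h2).elim
    · rintro ⟨h2, h3⟩
      exact ⟨h2, Or.inl h3⟩

lemma lr_many (l m n : ℕ → ℕ) (hl : IsPartition l) (T : ℕ → ℕ → ℕ)
    (hT : IsLR l m n T)
    (s K : ℕ) : ∀ k,
    Set.ncard {j | k + 1 ≤ T s j ∧ T s j < k + 1 + K} ≤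
      Nat.card {p : ℕ × ℕ // T p.1 p.2 = k + 1 ∧ p.1 ≤ s} := by
  have hfr : ∀ P : ℕ → Prop, (∀ j, P j → T s j ≠ 0) → {j | P j}.Finite := by
    intro P hP
    apply (Set.finite_Iio (l s)).subset
    intro j hj
    exact ((hT.support (s, j)).1 (hP j hj)).2
  induction K with
  | zero =>
    intro k
    have : {j | k + 1 ≤ T s j ∧ T s j < k + 1 + 0} = ∅ := by
      ext j
      simp
    rw [this]
    simp
  | succ K ih =>
    intro k
    have h1 := (ih (k + 1)).trans (lr_step l m n hl T hT s k)
    have e1 : {j | k + 1 ≤ T s j ∧ T s j < k + 1 + (K + 1)} =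
        {j | T s j = k + 1} ∪ {j | k + 1 + 1 ≤ T s j ∧ T s j < k + 1 + 1 + K} := by
      ext j
      simp only [Set.mem_setOf_eq, Set.mem_union]
      omega
    have e2 : {p : ℕ × ℕ | T p.1 p.2 = k + 1 ∧ p.1 ≤ s} =
        (Set.image (fun j => (s, j)) {j | T s j = k + 1}) ∪
          {p : ℕ × ℕ | T p.1 p.2 = k + 1 ∧ p.1 < s} := by
      ext ⟨a, b⟩
      simp only [Set.mem_setOf_eq, Set.mem_union, Set.mem_image, Prod.mk.injEq]
      constructor
      · rintro ⟨h2, h3⟩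
        rcases h3.lt_or_eq with h | h
        · exact Or.inr ⟨h2, h⟩
        · subst h
          exact Or.inl ⟨b, h2, rfl, rfl⟩
      · rintro (⟨x, h2, rfl, rfl⟩ | ⟨h2, h3⟩)
        · exact ⟨h2, le_rfl⟩
        · exact ⟨h2, h3.le⟩
    have e3 : Nat.card {p : ℕ × ℕ // T p.1 p.2 = k + 1 ∧ p.1 ≤ s} =
        Set.ncard {j | T s j = k + 1} +
          Nat.card {p : ℕ × ℕ // T p.1 p.2 = k + 1 ∧ p.1 < s} := by
      have h2 : Nat.card {p : ℕ × ℕ // T p.1 p.2 = k + 1 ∧ p.1 ≤ s} =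
        Set.ncard {p : ℕ × ℕ | T p.1 p.2 = k + 1 ∧ p.1 ≤ s} := rfl
      have f1 : (Set.image (fun j => (s, j)) {j | T s j = k + 1}).Finite :=
        (hfr _ (by intro j hj; omega)).image _
      have f2 : {p : ℕ × ℕ | T p.1 p.2 = k + 1 ∧ p.1 < s}.Finite :=
        fin_supp l m hl T (fun p hp => (hT.support p).1 hp) _
          (by rintro p ⟨hp, -⟩; omega)
      rw [h2, e2, Set.ncard_union_eq ?_ f1 f2, Set.ncard_image_of_injective]
      · rfl
      · intro a b h
        simpa using h
      · rw [Set.disjoint_left]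
        rintro ⟨a, b⟩ ⟨x, -, h⟩ ⟨-, h'⟩
        simp only [Prod.mk.injEq] at h h'
        omega
    rw [e1, e3]
    exact (Set.ncard_union_le _ _).trans (by omega)

lemma lr_lower (l m n : ℕ → ℕ) (hl : IsPartition l) (hm : IsPartition m) (T : ℕ → ℕ → ℕ)
    (hT : IsLR l m n T)
    (i s : ℕ) : ovl l m i s ≤ n i := by
  unfold ovl
  split_ifs with his
  swap
  · omega
  have hcol : ∀ j, m (s - i) ≤ j → j < l s → ∀ q, q ≤ i → q + 1 ≤ T (s - i + q) j := by
    intro j hj hj' q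
    have hin : ∀ q, q ≤ i → InSkew l m (s - i + q, j) := by
      intro q hq
      have a := hm.1 (show s - i ≤ s - i + q by omega)
      have b := hl.1 (show s - i + q ≤ s by omega)
      exact ⟨by dsimp only; omega, by dsimp only; omega⟩
    induction q with
    | zero =>
      intro hq
      have := (hT.support (s - i + 0, j)).2 (hin 0 hq)
      dsimp only at this
      omega
    | succ q ih =>
      intro hq
      have h1 := ih (by omega)
      have h2 := hT.col_strict (s - i + q) j (hin q (by omega)) (hin (q + 1) hq)
      have e : s - i + (q + 1) = s - i + q + 1 := by omega
      rw [e]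
      omega
  have hcol' : ∀ j, m (s - i) ≤ j → j < l s → i + 1 ≤ T s j := by
    intro j h1 h2
    have := hcol j h1 h2 i le_rfl
    rwa [Nat.sub_add_cancel his] at this
  obtain ⟨K, hK⟩ : ∃ K, ∀ j, j < l s → T s j < K := by
    refine ⟨(Finset.range (l s)).sup (fun j => T s j) + 1, fun j hj => ?_⟩
    have := Finset.le_sup (f := fun j => T s j) (Finset.mem_range.2 hj)
    omega
  have h1 := lr_many l m n hl T hT s K i
  have h2 : l s - m (s - i) ≤ Set.ncard {j | i + 1 ≤ T s j ∧ T s j < i + 1 + K} := by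
    have e : Set.ncard (Set.Ico (m (s - i)) (l s)) = l s - m (s - i) := by
      rw [← Finset.coe_Ico, Set.ncard_coe_finset, Nat.card_Ico]
    rw [← e]
    apply Set.ncard_le_ncard
    · intro j hj
      have a := hcol' j hj.1 hj.2
      have b := hK j hj.2
      exact ⟨a, by omega⟩
    · apply (Set.finite_Iio (l s)).subset
      intro j hj
      exact ((hT.support (s, j)).1 (by have := hj.1; dsimp only; omega)).2
  have h3 : Nat.card {p : ℕ × ℕ // T p.1 p.2 = i + 1 ∧ p.1 ≤ s} ≤ n i := by
    rw [← hT.content i]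
    apply card_le_of_rel _ _ (fin_supp l m hl T (fun p hp => (hT.support p).1 hp) _
          (by intro p hp; omega)) (fun p q => p = q)
    · intro p hp
      exact ⟨p, hp.1, rfl⟩
    · rintro p p' q - - rfl rfl
      rfl
  omega


lemma contained_le (a l m : ℕ → ℕ) (ha : IsPartition a) (h : ContainedIn a l m) (i : ℕ) :
    a i = 0 ∨ ∃ s, a i ≤ ovl l m i s := by
  by_cases h0 : a i = 0
  · exact Or.inl h0
  right
  have h1 := ha.1 (Nat.zero_le i)
  rcases h with ⟨r, c, h⟩ | ⟨r, c, h⟩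
  · have h2 := h 0 0 (by omega)
    have h3 := h i (a i - 1) (by omega)
    have h4 := h2.1
    have h5 := h3.2
    refine ⟨r + i, ?_⟩
    unfold ovl
    rw [if_pos (by omega), Nat.add_sub_cancel]
    simp only [Nat.add_zero] at h4 h5
    omega
  · have h2 := h 0 0 (by omega)
    have h3 := h i (a i - 1) (by omega)
    have h4 := h2.2.2.2
    have h5 := h3.2.2.1
    have h6 := h3.2.1
    refine ⟨r, ?_⟩
    unfold ovl
    rw [if_pos h3.1]
    simp only [Nat.sub_zero] at h4 h5
    omega

lemma exists_contained (l m : ℕ → ℕ) (hl : IsPartition l) (hm : IsPartition m) (i s : ℕ) :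
    ∃ a, IsPartition a ∧ ContainedIn a l m ∧ a i = ovl l m i s := by
  refine ⟨fun q => if q ≤ i then ovl l m i s else 0, ⟨?_, i + 1, ?_⟩, Or.inl ⟨s - i, m (s - i), ?_⟩,
    by simp⟩
  · intro a b h
    dsimp only
    split_ifs <;> omega
  · intro q hq
    exact if_neg (by omega)
  · intro q j hj
    dsimp only at hj
    unfold ovl at hj
    split_ifs at hj with h1 h2
    · have a := hm.1 (show s - i ≤ s - i + q by omega)
      have b := hl.1 (show s - i + q ≤ s by omega)
      exact ⟨by dsimp only; omega, by dsimp only; omega⟩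
    all_goals omega

/-- The union partition of all partitions contained in the skew diagram `l / m`
equals the base partition of the skew character `[l / m]` (the componentwise
minimum of all partitions `n` with `c(l; m, n) ≠ 0`). -/
theorem stmt4 (l m : ℕ → ℕ) (hl : IsPartition l) (hm : IsPartition m)
    (hml : ∀ i, m i ≤ l i) :
    ∀ i : ℕ,
      sSup {x | ∃ a, IsPartition a ∧ ContainedIn a l m ∧ a i = x} =
        sInf {x | ∃ n, IsPartition n ∧ LR l m n ≠ 0 ∧ n i = x} := by
  intro i
  have hbd : ∀ s, ovl l m i s ≤ l 0 := by
    intro s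
    unfold ovl
    have := hl.1 (Nat.zero_le s)
    split_ifs <;> omega
  obtain ⟨s0, hs0⟩ : ∃ s0, ∀ s, ovl l m i s ≤ ovl l m i s0 := by
    have hne : (Set.range (ovl l m i)).Nonempty := ⟨_, 0, rfl⟩
    have hba : BddAbove (Set.range (ovl l m i)) := ⟨l 0, by rintro _ ⟨s, rfl⟩; exact hbd s⟩
    obtain ⟨s0, h⟩ := Nat.sSup_mem hne hba
    exact ⟨s0, fun s => h ▸ le_csSup hba ⟨s, rfl⟩⟩
  have h1 : IsGreatest {x | ∃ a, IsPartition a ∧ ContainedIn a l m ∧ a i = x} (ovl l m i s0) := by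
    refine ⟨exists_contained l m hl hm i s0, ?_⟩
    rintro _ ⟨a, ha, hc, rfl⟩
    rcases contained_le a l m ha hc i with h | ⟨s, h⟩
    · omega
    · exact h.trans (hs0 s)
  have hlow : ∀ n, LR l m n ≠ 0 → ovl l m i s0 ≤ n i := by
    intro n hn
    have : Nonempty {T : ℕ → ℕ → ℕ // IsLR l m n T} := by
      by_contra hc
      rw [not_nonempty_iff] at hc
      exact hn Nat.card_of_isEmpty
    obtain ⟨T, hT⟩ := this
    exact lr_lower l m n hl hm T hT i s0
  have h2 : IsLeast {x | ∃ n, IsPartition n ∧ LR l m n ≠ 0 ∧ n i = x} (ovl l m i s0) := by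
    constructor
    · obtain ⟨n, hn, hLR, hle⟩ := exists_small l m hl hm i _ hs0
      exact ⟨n, hn, hLR, le_antisymm hle (hlow n hLR)⟩
    · rintro _ ⟨n, hn, hLR, rfl⟩
      exact hlow n hLR
  rw [h1.csSup_eq, h2.csInf_eq]
end

section
/- Let μ, ν be partitions, k, l fixed integers with μ, ν ⊆ (k^l) and |μ| + |ν| ≤ kl, and let A be the skew diagram obtained from the rectangle (k^l) by removing ν from the upper-left corner and the 180° rotation of μ from the lower-right corner (i.e., A = (((k^l)/μ)° )/ν). Then the cover partition of the Schubert product, C([μ] ⋆_{(k^l)} [ν])_i := max{η_i : η ⊆ (k^l), c(η; μ, ν) ≠ 0}, equals the 180° rotation of (k^l)/B([A]), where B([A]) is the base partition of the skew character [A]; explicitly C_i = k − B([A])_{l+1−i}. -/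
open Finset

/-- Number of cells `c < e i` of row `i` with entry at most `j`. -/
def rowLe (e : ℕ → ℕ) (T : ℕ → ℕ → ℕ) (i j : ℕ) : ℕ :=
  ((range (e i)).filter (fun c => T i c ≤ j)).card

/-- Number of cells of row `i` with entry equal to `v`. -/
def rowEq (e : ℕ → ℕ) (T : ℕ → ℕ → ℕ) (i v : ℕ) : ℕ :=
  ((range (e i)).filter (fun c => T i c = v)).card

theorem rowEq_add (e : ℕ → ℕ) (T : ℕ → ℕ → ℕ) (i v : ℕ) :
    rowEq e T i (v + 1) + rowLe e T i v = rowLe e T i (v + 1) := by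
  unfold rowEq rowLe
  rw [← card_union_of_disjoint]
  · congr 1
    ext c
    simp only [mem_union, mem_filter, mem_range]
    omega
  · rw [disjoint_left]
    intro c
    simp only [mem_filter, mem_range]
    omega

theorem card_mono_sub {P Q : ℕ × ℕ → Prop} (h : ∀ p, P p → Q p) (hf : Set.Finite {p | Q p}) :
    Nat.card {p // P p} ≤ Nat.card {p // Q p} := by
  haveI : Finite {p // Q p} := hf
  exact Nat.card_le_card_of_injective (fun p : {p // P p} => (⟨p.1, h _ p.2⟩ : {p // Q p}))
    (fun a b hab => by
      apply Subtype.ext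
      exact congrArg (fun z : {p // Q p} => z.1) hab)

theorem card_rows (e : ℕ → ℕ) (T : ℕ → ℕ → ℕ) (hT : ∀ i c, T i c ≠ 0 → c < e i) (i v : ℕ) :
    Nat.card {p : ℕ × ℕ // T p.1 p.2 = v + 1 ∧ p.1 < i} = ∑ p ∈ range i, rowEq e T p (v + 1) := by
  rw [Nat.subtype_card
    (((range i).sigma (fun p => (range (e p)).filter (fun c => T p c = v + 1))).map
      (Equiv.sigmaEquivProd ℕ ℕ).toEmbedding)]
  · rw [card_map, card_sigma]
    rfl
  · rintro ⟨a, b⟩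
    simp only [mem_map_equiv, mem_sigma, mem_filter, mem_range, Equiv.sigmaEquivProd_symm_apply]
    constructor
    · rintro ⟨h1, h2, h3⟩
      exact ⟨h3, h1⟩
    · rintro ⟨h1, h2⟩
      exact ⟨h2, hT _ _ (by omega), h1⟩

theorem sum_rowEq (e : ℕ → ℕ) (T : ℕ → ℕ → ℕ) (i v : ℕ) :
    (∑ p ∈ range i, rowEq e T p (v + 1)) + ∑ p ∈ range i, rowLe e T p v =
      ∑ p ∈ range i, rowLe e T p (v + 1) := by
  rw [← sum_add_distrib]
  exact sum_congr rfl (fun p _ => rowEq_add e T p v)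

theorem supp_finite (L : ℕ) (e : ℕ → ℕ) (he : IsPartition e) (heL : ∀ i, L ≤ i → e i = 0)
    (T : ℕ → ℕ → ℕ) (hT : ∀ i c, T i c ≠ 0 → c < e i) :
    Set.Finite {p : ℕ × ℕ | T p.1 p.2 ≠ 0} := by
  apply Set.Finite.subset (((range L) ×ˢ (range (e 0))).finite_toSet)
  rintro ⟨a, b⟩ h
  have h1 := hT a b h
  have h2 := he.1 (Nat.zero_le a)
  simp only [coe_product, coe_range, Set.mem_prod, Set.mem_Iio]
  refine ⟨?_, by omega⟩
  by_contra hc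
  have := heL a (by omega)
  omega

section tab
variable {L : ℕ} {e m n : ℕ → ℕ} {T : ℕ → ℕ → ℕ}

theorem IsLR.lt (h : IsLR e m n T) : ∀ i c, T i c ≠ 0 → c < e i :=
  fun i c hc => ((h.support (i, c)).1 hc).2

theorem IsLR.row_mono (h : IsLR e m n T) (i c d : ℕ) (hcd : c ≤ d) (hd : d < e i) :
    T i c ≤ T i d := by
  induction d, hcd using Nat.le_induction with
  | base => exact le_rfl
  | succ d hcd ih =>
    refine (ih (by omega)).trans ?_
    by_cases hz : T i d = 0
    · omega
    · have h1 := (h.support (i, d)).1 hz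
      refine h.row_weak i d h1 ⟨?_, hd⟩
      have := h1.1
      simp only at this ⊢
      omega

theorem IsLR.entry_le (h : IsLR e m n T) (he : IsPartition e) (heL : ∀ i, L ≤ i → e i = 0)
    (v : ℕ) : ∀ i c, T i c = v + 1 → v ≤ i := by
  have hfin := supp_finite L e he heL T h.lt
  induction v with
  | zero => intros; omega
  | succ v ih =>
    intro i c hc
    have hl := h.lattice i c v
    have hpos : 0 < Nat.card {p : ℕ × ℕ // T p.1 p.2 = v + 2 ∧ (p.1 < i ∨ (p.1 = i ∧ c ≤ p.2))} := by
      haveI : Finite {p : ℕ × ℕ // T p.1 p.2 = v + 2 ∧ (p.1 < i ∨ (p.1 = i ∧ c ≤ p.2))} :=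
        hfin.subset (fun p hp => by
          have := hp.1
          simp only [Set.mem_ofPred_eq]
          omega)
      haveI : Nonempty {p : ℕ × ℕ // T p.1 p.2 = v + 2 ∧ (p.1 < i ∨ (p.1 = i ∧ c ≤ p.2))} :=
        ⟨⟨(i, c), hc, Or.inr ⟨rfl, le_rfl⟩⟩⟩
      exact Nat.card_pos
    have hpos2 := lt_of_lt_of_le hpos hl
    obtain ⟨⟨⟨⟨a, b⟩, hab, hor⟩⟩, _⟩ := Nat.card_pos_iff.1 hpos2
    simp only at hab hor
    rcases hor with h1 | ⟨h1, h2⟩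
    · have := ih a b hab
      omega
    · subst h1
      have h3 := h.row_mono a c b h2 (h.lt a b (by omega))
      omega

theorem IsLR.total (h : IsLR e m n T) (heL : ∀ i, L ≤ i → e i = 0) (v : ℕ) :
    ∑ p ∈ range L, rowEq e T p (v + 1) = n v := by
  rw [← h.content v, ← card_rows e T h.lt]
  apply Nat.card_congr
  apply Equiv.subtypeEquivRight
  rintro ⟨a, b⟩
  simp only [and_iff_left_iff_imp]
  intro hv
  have := h.lt a b (by omega)
  by_contra hc
  have := heL a (by omega)
  omega

theorem IsLR.rowLe_col (h : IsLR e m n T) (he : IsPartition e) (hm : IsPartition m) (i j : ℕ) :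
    rowLe e T (i + 1) (j + 1) ≤ rowLe e T i j := by
  apply card_le_card
  intro c
  simp only [mem_filter, mem_range]
  rintro ⟨h1, h2⟩
  have h3 := he.1 (by omega : i ≤ i + 1)
  have h4 := hm.1 (by omega : i ≤ i + 1)
  refine ⟨by omega, ?_⟩
  by_cases hz : T i c = 0
  · omega
  · have h5 := (h.support (i, c)).1 hz
    have h6 := h.col_strict i c h5 ⟨by have := h5.1; simp only at this ⊢; omega, h1⟩
    omega

theorem IsLR.content_le (h : IsLR e m n T) (he : IsPartition e) (hm : IsPartition m)
    (heL : ∀ i, L ≤ i → e i = 0) (v : ℕ) : n v ≤ e 0 := by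
  rw [← h.total heL]
  have key : ∀ i, ∑ p ∈ range (i + 1), rowLe e T p (v + 1) ≤ e 0 + ∑ p ∈ range i, rowLe e T p v := by
    intro i
    induction i with
    | zero =>
      simp only [zero_add, sum_range_one, range_zero, sum_empty, add_zero]
      exact (card_filter_le _ _).trans (by simp)
    | succ i ih =>
      rw [sum_range_succ _ (i + 1), sum_range_succ (fun p => rowLe e T p v) i]
      have := h.rowLe_col he hm i v
      omega
  have h1 := sum_rowEq e T L v
  have h2 := key L
  rw [sum_range_succ] at h2
  omega

theorem IsLR.content_zero (h : IsLR e m n T) (he : IsPartition e)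
    (heL : ∀ i, L ≤ i → e i = 0) (v : ℕ) (hv : L ≤ v) : n v = 0 := by
  rw [← h.content v]
  haveI : IsEmpty {p : ℕ × ℕ // T p.1 p.2 = v + 1} := ⟨by
    rintro ⟨⟨a, b⟩, hab⟩
    simp only at hab
    have h1 := h.entry_le he heL v a b hab
    have h2 := h.lt a b (by omega)
    have := heL a (by omega)
    omega⟩
  exact Nat.card_of_isEmpty

theorem IsLR.lattice_rows (h : IsLR e m n T) (he : IsPartition e)
    (heL : ∀ i, L ≤ i → e i = 0) (i v : ℕ) :
    ∑ p ∈ range (i + 1), rowEq e T p (v + 2) ≤ ∑ p ∈ range i, rowEq e T p (v + 1) := by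
  have hfin := supp_finite L e he heL T h.lt
  rw [← card_rows e T h.lt, ← card_rows e T h.lt]
  have hf : ∀ (w : ℕ) (Q : ℕ × ℕ → Prop), Set.Finite {p : ℕ × ℕ | T p.1 p.2 = w + 1 ∧ Q p} := by
    intro w Q
    refine hfin.subset (fun p hp => ?_)
    have := hp.1
    simp only [Set.mem_ofPred_eq]
    omega
  have key : ∃ s, (∀ c, T i c = v + 2 → s ≤ c) ∧ (∀ c, s ≤ c → T i c ≠ v + 1) := by
    by_cases hex : ∃ c, T i c = v + 2
    · classical
      refine ⟨Nat.find hex, fun c hc => Nat.find_min' hex hc, fun c hc hc2 => ?_⟩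
      have h1 := Nat.find_spec hex
      have h2 := h.row_mono i _ c hc (h.lt i c (by omega))
      omega
    · push Not at hex
      refine ⟨e i, fun c hc => absurd hc (hex c), fun c hc hc2 => ?_⟩
      have := h.lt i c (by omega)
      omega
  obtain ⟨s, hs1, hs2⟩ := key
  refine le_trans (card_mono_sub ?_ (hf (v + 1) _)) ((h.lattice i s v).trans (card_mono_sub ?_ (hf v _)))
  · rintro ⟨a, b⟩ ⟨h1, h2⟩
    simp only at h1 h2 ⊢
    refine ⟨h1, ?_⟩
    rcases Nat.lt_or_ge a i with h3 | h3
    · exact Or.inl h3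
    · have h4 : a = i := by omega
      subst h4
      exact Or.inr ⟨rfl, hs1 b h1⟩
  · rintro ⟨a, b⟩ ⟨h1, h2⟩
    simp only at h1 h2 ⊢
    refine ⟨h1, ?_⟩
    rcases h2 with h3 | ⟨h3, h4⟩
    · exact h3
    · subst h3
      exact absurd h1 (hs2 b h4)

end tab

theorem LR_finite (L : ℕ) (e m n : ℕ → ℕ) (he : IsPartition e) (heL : ∀ i, L ≤ i → e i = 0) :
    Finite {T : ℕ → ℕ → ℕ // IsLR e m n T} := by
  have hb : ∀ (T : {T : ℕ → ℕ → ℕ // IsLR e m n T}) (i c : ℕ), T.1 i c < L + 1 := by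
    intro T i c
    rcases Nat.eq_zero_or_pos (T.1 i c) with h | h
    · omega
    · have h1 := T.2.entry_le he heL (T.1 i c - 1) i c (by omega)
      have h2 := T.2.lt i c (by omega)
      by_contra hc
      have := heL i (by omega)
      omega
  let f : {T : ℕ → ℕ → ℕ // IsLR e m n T} → (Fin L → Fin (e 0) → Fin (L + 1)) :=
    fun T i c => ⟨T.1 i c, hb T i c⟩
  apply Finite.of_injective f
  intro S T hST
  apply Subtype.ext
  funext i c
  by_cases hin : i < L ∧ c < e 0
  · have := congrFun (congrFun hST ⟨i, hin.1⟩) ⟨c, hin.2⟩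
    exact congrArg Fin.val this
  · have hz : ∀ (T : {T : ℕ → ℕ → ℕ // IsLR e m n T}), T.1 i c = 0 := by
      intro T
      by_contra hne
      have h1 := T.2.lt i c hne
      have h2 := he.1 (Nat.zero_le i)
      apply hin
      refine ⟨?_, by omega⟩
      by_contra hc
      have := heL i (by omega)
      omega
    rw [hz S, hz T]

theorem LR_ne_zero_iff (L : ℕ) (e m n : ℕ → ℕ) (he : IsPartition e) (heL : ∀ i, L ≤ i → e i = 0) :
    LR e m n ≠ 0 ↔ ∃ T, IsLR e m n T := by
  haveI := LR_finite L e m n he heL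
  unfold LR
  rw [Nat.card_ne_zero]
  constructor
  · rintro ⟨⟨T, hT⟩, _⟩
    exact ⟨T, hT⟩
  · rintro ⟨T, hT⟩
    exact ⟨⟨T, hT⟩, this⟩

/-- Hives of size `L` with boundary `m`, `n`, `e`. -/
structure IsHive (L : ℕ) (m n e : ℕ → ℕ) (h : ℕ → ℕ → ℤ) : Prop where
  left : ∀ i, i ≤ L → h i 0 = ∑ p ∈ range i, (m p : ℤ)
  bot : ∀ j, j ≤ L → h L j = ∑ p ∈ range L, (m p : ℤ) + ∑ q ∈ range j, (n q : ℤ)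
  diag : ∀ i, i ≤ L → h i i = ∑ p ∈ range i, (e p : ℤ)
  R1 : ∀ i j, j ≤ i → i + 2 ≤ L →
    h (i + 2) (j + 1) - h (i + 1) (j + 1) ≤ h (i + 1) j - h i j
  R2 : ∀ i j, j + 1 ≤ i → i + 1 ≤ L →
    h (i + 1) j - h i j ≤ h (i + 1) (j + 1) - h i (j + 1)
  R3 : ∀ i j, j + 1 ≤ i → i + 1 ≤ L →
    h (i + 1) (j + 2) - h (i + 1) (j + 1) ≤ h i (j + 1) - h i j

theorem IsLR.hive {L : ℕ} {e m n : ℕ → ℕ} {T : ℕ → ℕ → ℕ} (h : IsLR e m n T)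
    (he : IsPartition e) (hm : IsPartition m) (heL : ∀ i, L ≤ i → e i = 0)
    (hme : ∀ i, m i ≤ e i) :
    IsHive L m n e (fun i j => ((∑ p ∈ range i, rowLe e T p j : ℕ) : ℤ)) := by
  have h0 : ∀ i, rowLe e T i 0 = m i := by
    intro i
    have : (range (e i)).filter (fun c => T i c ≤ 0) = range (m i) := by
      ext c
      simp only [mem_filter, mem_range]
      have h1 := h.support (i, c)
      unfold InSkew at h1
      simp only at h1
      have h2 := hme i
      constructor
      · rintro ⟨h3, h4⟩
        by_contra hc
        exact h1.2 ⟨by omega, h3⟩ (by omega)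
      · intro h3
        refine ⟨by omega, ?_⟩
        by_contra hc
        have := h1.1 (by omega)
        omega
    unfold rowLe
    rw [this, card_range]
  have hd : ∀ i j, i < j → rowLe e T i j = e i := by
    intro i j hij
    unfold rowLe
    rw [filter_true_of_mem, card_range]
    intro c _
    rcases Nat.eq_zero_or_pos (T i c) with hz | hz
    · omega
    · have := h.entry_le he heL (T i c - 1) i c (by omega)
      omega
  have hbot : ∀ j, ∑ p ∈ range L, rowLe e T p j = ∑ p ∈ range L, m p + ∑ q ∈ range j, n q := by
    intro j
    induction j with
    | zero => simp [h0]
    | succ j ih =>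
      rw [sum_range_succ, ← sum_rowEq, h.total heL, ih]
      omega
  refine ⟨?_, ?_, ?_, ?_, ?_, ?_⟩
  · intro i _
    simp only [h0]
    push_cast
    rfl
  · intro j _
    simp only [hbot]
    push_cast
    rfl
  · intro i _
    have : ∑ p ∈ range i, rowLe e T p i = ∑ p ∈ range i, e p :=
      sum_congr rfl (fun p hp => hd p i (mem_range.1 hp))
    simp only [this]
    push_cast
    rfl
  · intro i j _ _
    have h1 := h.rowLe_col he hm i j
    simp only [sum_range_succ]
    push_cast
    omega
  · intro i j _ _
    have h1 := rowEq_add e T i j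
    simp only [sum_range_succ]
    push_cast
    omega
  · intro i j _ _
    have h1 := h.lattice_rows he heL i j
    have h2 := sum_rowEq e T (i + 1) (j + 1)
    have h3 := sum_rowEq e T i j
    have h4 : j + 1 + 1 = j + 2 := rfl
    rw [h4] at h2
    have key : ((∑ p ∈ range (i + 1), rowLe e T p (j + 2) : ℕ) : ℤ)
      - ((∑ p ∈ range (i + 1), rowLe e T p (j + 1) : ℕ) : ℤ) ≤
      ((∑ p ∈ range i, rowLe e T p (j + 1) : ℕ) : ℤ) - ((∑ p ∈ range i, rowLe e T p j : ℕ) : ℤ) := by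
      omega
    exact key

theorem sum_rot (k L : ℕ) (f : ℕ → ℕ) (hfk : ∀ i, f i ≤ k) (j : ℕ) (hj : j ≤ L) :
    ∑ q ∈ range j, (RotCompl k L f q : ℤ) =
      (k : ℤ) * j + ∑ p ∈ range (L - j), (f p : ℤ) - ∑ p ∈ range L, (f p : ℤ) := by
  induction j with
  | zero => simp
  | succ j ih =>
    rw [sum_range_succ, ih (by omega)]
    have h1 : L - j = (L - (j + 1)) + 1 := by omega
    rw [h1, sum_range_succ]
    have h2 : (RotCompl k L f j : ℤ) = k - f (L - (j + 1)) := by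
      unfold RotCompl
      rw [if_pos (by omega)]
      have h3 : L - 1 - j = L - (j + 1) := by omega
      rw [h3, Nat.cast_sub (hfk _)]
    rw [h2]
    push_cast
    ring

theorem IsHive.rot {L k : ℕ} {m n e : ℕ → ℕ} {h : ℕ → ℕ → ℤ} (H : IsHive L m n e h)
    (hmk : ∀ i, m i ≤ k) (hek : ∀ i, e i ≤ k) :
    IsHive L n (RotCompl k L e) (RotCompl k L m)
      (fun i j => h (L - j) (i - j) - h L 0 + k * j) := by
  have hLL := H.diag L le_rfl
  have hLL' := H.bot L le_rfl
  have hL0 := H.left L le_rfl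
  refine ⟨?_, ?_, ?_, ?_, ?_, ?_⟩
  · intro i hi
    have := H.bot i hi
    simp only [Nat.sub_zero, Nat.cast_zero, mul_zero, add_zero]
    linarith
  · intro j hj
    have := H.diag (L - j) (by omega)
    rw [sum_rot k L e hek j hj]
    linarith
  · intro i hi
    have := H.left (L - i) (by omega)
    simp only [Nat.sub_self]
    rw [sum_rot k L m hmk i hi]
    linarith
  · intro i j hj hi
    obtain ⟨b, rfl⟩ := Nat.exists_eq_add_of_le hj
    obtain ⟨d, rfl⟩ := Nat.exists_eq_add_of_le hi
    have := H.R2 (b + d + 1) b (by omega) (by omega)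
    have e1 : j + b + 2 + d - (j + 1) = b + d + 1 := by omega
    have e2 : j + b + 2 + d - j = b + d + 1 + 1 := by omega
    have e3 : j + b + 2 - (j + 1) = b + 1 := by omega
    have e4 : j + b + 1 - (j + 1) = b := by omega
    have e5 : j + b + 1 - j = b + 1 := by omega
    have e6 : j + b - j = b := by omega
    simp only [e1, e2, e3, e4, e5, e6]
    push_cast
    linarith
  · intro i j hj hi
    obtain ⟨b, rfl⟩ := Nat.exists_eq_add_of_le hj
    obtain ⟨d, rfl⟩ := Nat.exists_eq_add_of_le hi
    have := H.R3 (b + d + 1) b (by omega) (by omega)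
    have e1 : j + 1 + b + 1 + d - (j + 1) = b + d + 1 := by omega
    have e2 : j + 1 + b + 1 + d - j = b + d + 1 + 1 := by omega
    have e3 : j + 1 + b + 1 - (j + 1) = b + 1 := by omega
    have e4 : j + 1 + b + 1 - j = b + 2 := by omega
    have e5 : j + 1 + b - j = b + 1 := by omega
    have e6 : j + 1 + b - (j + 1) = b := by omega
    simp only [e1, e2, e3, e4, e5, e6]
    push_cast
    linarith
  · intro i j hj hi
    obtain ⟨b, rfl⟩ := Nat.exists_eq_add_of_le hj
    obtain ⟨d, rfl⟩ := Nat.exists_eq_add_of_le hi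
    have := H.R1 (b + d) b (by omega) (by omega)
    have e1 : j + 1 + b + 1 + d - (j + 1) = b + d + 1 := by omega
    have e2 : j + 1 + b + 1 + d - j = b + d + 2 := by omega
    have e2' : j + 1 + b + 1 + d - (j + 2) = b + d := by omega
    have e3 : j + 1 + b + 1 - (j + 1) = b + 1 := by omega
    have e4 : j + 1 + b + 1 - (j + 2) = b := by omega
    have e5 : j + 1 + b - j = b + 1 := by omega
    have e6 : j + 1 + b - (j + 1) = b := by omega
    simp only [e1, e2, e2', e3, e4, e5, e6]
    push_cast
    linarith

theorem count_le_iff (f : ℕ → ℤ) (i : ℕ) (hf : ∀ j, j < i → f j ≤ f (j + 1)) (c : ℤ) (j : ℕ)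
    (hj : j ≤ i) : ((range (i + 1)).filter (fun t => f t ≤ c)).card ≤ j ↔ c < f j := by
  have hmono : ∀ a b, a ≤ b → b ≤ i → f a ≤ f b := by
    intro a b hab
    induction b, hab using Nat.le_induction with
    | base => intro _; exact le_rfl
    | succ b hab ih =>
      intro hb
      exact (ih (by omega)).trans (hf b (by omega))
  constructor
  · intro h
    by_contra hc
    have hsub : range (j + 1) ⊆ (range (i + 1)).filter (fun t => f t ≤ c) := by
      intro t ht
      have ht' := mem_range.1 ht
      simp only [mem_filter, mem_range]
      have := hmono t j (by omega) hj
      exact ⟨by omega, by omega⟩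
    have := card_le_card hsub
    rw [card_range] at this
    omega
  · intro h
    have hsub : (range (i + 1)).filter (fun t => f t ≤ c) ⊆ range j := by
      intro t ht
      simp only [mem_filter, mem_range] at ht
      rw [mem_range]
      by_contra hc
      have := hmono j t (by omega) (by omega)
      omega
    have := card_le_card hsub
    rwa [card_range] at this

theorem IsHive.exists_LR {L : ℕ} {m n e : ℕ → ℕ} {h : ℕ → ℕ → ℤ} (H : IsHive L m n e h)
    (he : IsPartition e) (hn : IsPartition n)
    (heL : ∀ i, L ≤ i → e i = 0) (hnL : ∀ i, L ≤ i → n i = 0) :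
    ∃ T, IsLR e m n T := by
  classical
  -- extended hive
  set G : ℕ → ℕ → ℤ := fun i j => h i (min i j) with hG
  set g : ℕ → ℕ → ℤ := fun i j => G (i + 1) j - G i j with hg
  have hg0 : ∀ i, i < L → g i 0 = m i := by
    intro i hi
    simp only [hg, hG, Nat.min_zero]
    rw [H.left _ (by omega), H.left _ (by omega), sum_range_succ]
    ring
  have hge : ∀ i j, i < L → i < j → g i j = e i := by
    intro i j hi hj
    simp only [hg, hG]
    rw [min_eq_left (by omega : i + 1 ≤ j), min_eq_left (by omega : i ≤ j),
      H.diag _ (by omega), H.diag _ (by omega), sum_range_succ]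
    ring
  have hglow : ∀ i j, j ≤ i → g i j = h (i + 1) j - h i j := by
    intro i j hj
    simp only [hg, hG]
    rw [min_eq_right (by omega : j ≤ i + 1), min_eq_right hj]
  have hD : ∀ d i, i + 1 + d = L → 0 ≤ h (i + 1) (i + 1) - h (i + 1) i := by
    intro d
    induction d with
    | zero =>
      intro i hi
      have hi' : i + 1 = L := by omega
      rw [hi', H.bot L le_rfl, H.bot i (by omega), ← hi', sum_range_succ _ i, sum_range_succ _ i]
      have : (0 : ℤ) ≤ n i := Int.natCast_nonneg _
      linarith
    | succ d ih =>
      intro i hi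
      have h1 := ih (i + 1) (by omega)
      have h2 := H.R3 (i + 1) i (by omega) (by omega)
      have h3 : i + 1 + 1 = i + 2 := rfl
      rw [h3] at h1 h2
      linarith
  have hgmono : ∀ i j, i < L → g i j ≤ g i (j + 1) := by
    intro i j hi
    rcases lt_trichotomy j i with h1 | h1 | h1
    · rw [hglow i j (by omega), hglow i (j + 1) (by omega)]
      exact H.R2 i j (by omega) (by omega)
    · subst h1
      have h2 := hD (L - (j + 1)) j (by omega)
      rw [hglow j j le_rfl, hge j (j + 1) hi (by omega)]
      have h3 := H.diag (j + 1) (by omega)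
      have h4 := H.diag j (by omega)
      rw [sum_range_succ] at h3
      linarith
    · rw [hge i j hi h1, hge i (j + 1) hi (by omega)]
  have hgle : ∀ i j, i < L → g i j ≤ e i := by
    intro i j hi
    have : ∀ d, g i j ≤ g i (j + d) := by
      intro d
      induction d with
      | zero => exact le_rfl
      | succ d ih => exact ih.trans (hgmono i (j + d) hi)
    have h1 := this (i + 1)
    rwa [hge i (j + (i + 1)) hi (by omega)] at h1
  have hgm : ∀ i j, i < L → (m i : ℤ) ≤ g i j := by
    intro i j hi
    induction j with
    | zero => rw [hg0 i hi]
    | succ j ih => exact ih.trans (hgmono i j hi)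
  have hgcol : ∀ i j, i + 1 < L → g (i + 1) (j + 1) ≤ g i j := by
    intro i j hi
    rcases Nat.lt_or_ge i j with h1 | h1
    · rw [hge i j (by omega) h1, hge (i + 1) (j + 1) hi (by omega)]
      exact_mod_cast he.1 (by omega : i ≤ i + 1)
    · rw [hglow i j h1, hglow (i + 1) (j + 1) (by omega)]
      exact H.R1 i j h1 (by omega)
  -- the tableau
  set T : ℕ → ℕ → ℕ := fun i c =>
    if c < e i then ((range (i + 1)).filter (fun t => g i t ≤ (c : ℤ))).card else 0 with hT
  have hTle : ∀ i c j, c < e i → (T i c ≤ j ↔ (c : ℤ) < g i j) := by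
    intro i c j hc
    have hi : i < L := by
      by_contra hcon
      have := heL i (by omega)
      omega
    simp only [hT, if_pos hc]
    rcases Nat.lt_or_ge i j with h1 | h1
    · rw [hge i j hi h1]
      constructor
      · intro _
        exact_mod_cast hc
      · intro _
        refine (card_filter_le _ _).trans ?_
        rw [card_range]
        omega
    · exact count_le_iff (g i) i (fun j _ => hgmono i j hi) c j h1
  have hTlt : ∀ i c, T i c ≠ 0 → c < e i := by
    intro i c hne
    by_contra hc
    apply hne
    simp only [hT, if_neg hc]
  have heiL : ∀ i c, c < e i → i < L := by
    intro i c hc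
    by_contra hcon
    have := heL i (by omega)
    omega
  have hsupp : ∀ p : ℕ × ℕ, T p.1 p.2 ≠ 0 ↔ InSkew e m p := by
    rintro ⟨i, c⟩
    unfold InSkew
    simp only
    constructor
    · intro hne
      have h1 := hTlt i c hne
      refine ⟨?_, h1⟩
      have h2 := hTle i c 0 h1
      rw [hg0 i (heiL i c h1)] at h2
      by_contra hcon
      have := h2.2 (by omega)
      omega
    · rintro ⟨h1, h2⟩ hz
      have h3 := hTle i c 0 h2
      rw [hg0 i (heiL i c h2)] at h3
      have := h3.1 (by omega)
      omega
  have hrowLe : ∀ i j, i < L → (rowLe e T i j : ℤ) = g i j := by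
    intro i j hi
    have h1 := hgle i j hi
    have h2 := hgm i j hi
    have h3 : (range (e i)).filter (fun c => T i c ≤ j) = range (g i j).toNat := by
      ext c
      simp only [mem_filter, mem_range]
      constructor
      · rintro ⟨h4, h5⟩
        have := (hTle i c j h4).1 h5
        omega
      · intro h4
        have h5 : c < e i := by omega
        exact ⟨h5, (hTle i c j h5).2 (by omega)⟩
    unfold rowLe
    rw [h3, card_range]
    omega
  have hsum : ∀ i j, i ≤ L → ((∑ p ∈ range i, rowLe e T p j : ℕ) : ℤ) = G i j := by
    intro i j
    induction i with
    | zero =>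
      intro _
      have := H.left 0 (Nat.zero_le _)
      simp only [range_zero, sum_empty] at this
      simp [hG, this]
    | succ i ih =>
      intro hi
      rw [sum_range_succ, Nat.cast_add, ih (by omega), hrowLe i j (by omega)]
      simp only [hg]
      ring
  have hGL : ∀ j, G L (j + 1) - G L j = n j := by
    intro j
    simp only [hG]
    rcases Nat.lt_or_ge j L with h1 | h1
    · rw [min_eq_right (by omega : j + 1 ≤ L), min_eq_right (by omega : j ≤ L),
        H.bot _ (by omega), H.bot _ (by omega), sum_range_succ _ j]
      ring
    · rw [min_eq_left (by omega : L ≤ j + 1), min_eq_left h1, hnL j h1]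
      simp
  have htot : ∀ v, ∑ p ∈ range L, rowEq e T p (v + 1) = n v := by
    intro v
    have h1 := sum_rowEq e T L v
    have h2 := hsum L v le_rfl
    have h3 := hsum L (v + 1) le_rfl
    have h4 := hGL v
    omega
  have hfin := supp_finite L e he heL T hTlt
  have hf : ∀ (w : ℕ) (Q : ℕ × ℕ → Prop), Set.Finite {p : ℕ × ℕ | T p.1 p.2 = w + 1 ∧ Q p} := by
    intro w Q
    refine hfin.subset (fun p hp => ?_)
    have := hp.1
    simp only [Set.mem_ofPred_eq]
    omega
  refine ⟨T, hsupp, ?_, ?_, ?_, ?_⟩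
  · intro i c h1 h2
    have h3 : c + 1 < e i := h2.2
    have h4 := (hTle i (c + 1) (T i (c + 1)) h3).1 le_rfl
    exact (hTle i c _ (by omega)).2 (by push_cast at h4; omega)
  · intro i c h1 h2
    have h3 : c < e (i + 1) := h2.2
    have h4 : c < e i := h1.2
    have h5 := (hsupp (i + 1, c)).2 h2
    simp only at h5
    obtain ⟨j, hj⟩ := Nat.exists_eq_succ_of_ne_zero h5
    have h6 := (hTle (i + 1) c (j + 1) h3).1 (by omega)
    have h7 := hgcol i j (heiL _ _ h3)
    have h8 := (hTle i c j h4).2 (by omega)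
    omega
  · intro v
    rw [← htot v, ← card_rows e T hTlt]
    apply Nat.card_congr
    apply Equiv.subtypeEquivRight
    rintro ⟨a, b⟩
    simp only
    constructor
    · intro hv
      exact ⟨hv, heiL a b (hTlt a b (by omega))⟩
    · exact fun hv => hv.1
  · intro i j v
    rcases Nat.lt_or_ge i L with hi | hi
    · have key : ∑ p ∈ range (i + 1), rowEq e T p (v + 1 + 1) ≤
          ∑ p ∈ range i, rowEq e T p (v + 1) := by
        have h1 := sum_rowEq e T (i + 1) (v + 1)
        have h2 := sum_rowEq e T i v
        have h3 := hsum (i + 1) (v + 1) (by omega)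
        have h4 := hsum (i + 1) (v + 1 + 1) (by omega)
        have h5 := hsum i v (by omega)
        have h6 := hsum i (v + 1) (by omega)
        have h7 : G (i + 1) (v + 1 + 1) - G (i + 1) (v + 1) ≤ G i (v + 1) - G i v := by
          simp only [hG]
          rcases Nat.lt_or_ge v i with hv | hv
          · rw [min_eq_right (by omega : v + 1 + 1 ≤ i + 1), min_eq_right (by omega : v + 1 ≤ i + 1),
              min_eq_right (by omega : v + 1 ≤ i), min_eq_right (by omega : v ≤ i)]
            exact H.R3 i v (by omega) (by omega)
          · rw [min_eq_left (by omega : i + 1 ≤ v + 1 + 1), min_eq_left (by omega : i + 1 ≤ v + 1),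
              min_eq_left (by omega : i ≤ v + 1), min_eq_left (by omega : i ≤ v)]
            simp
        omega
      rw [← card_rows e T hTlt, ← card_rows e T hTlt] at key
      refine le_trans (card_mono_sub ?_ (hf (v + 1) _)) (key.trans (card_mono_sub ?_ (hf v _)))
      · rintro ⟨a, b⟩ ⟨h1, h2⟩
        simp only at h1 h2 ⊢
        exact ⟨h1, by omega⟩
      · rintro ⟨a, b⟩ ⟨h1, h2⟩
        simp only at h1 h2 ⊢
        exact ⟨h1, Or.inl h2⟩
    · have key : ∑ p ∈ range L, rowEq e T p (v + 1 + 1) ≤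
          ∑ p ∈ range L, rowEq e T p (v + 1) := by
        rw [htot, htot]
        exact hn.1 (Nat.le_succ v)
      rw [← card_rows e T hTlt, ← card_rows e T hTlt] at key
      refine le_trans (card_mono_sub ?_ (hf (v + 1) _)) (key.trans (card_mono_sub ?_ (hf v _)))
      · rintro ⟨a, b⟩ ⟨h1, h2⟩
        simp only at h1 h2 ⊢
        exact ⟨h1, heiL a b (hTlt a b (by omega))⟩
      · rintro ⟨a, b⟩ ⟨h1, h2⟩
        simp only at h1 h2 ⊢
        exact ⟨h1, by omega⟩

theorem rot_le (k L : ℕ) (f : ℕ → ℕ) (i : ℕ) : RotCompl k L f i ≤ k := by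
  unfold RotCompl
  split_ifs <;> omega

theorem rot_zero (k L : ℕ) (f : ℕ → ℕ) (i : ℕ) (hi : L ≤ i) : RotCompl k L f i = 0 := by
  unfold RotCompl
  rw [if_neg (by omega)]

theorem rot_part (k L : ℕ) (f : ℕ → ℕ) (hf : IsPartition f) : IsPartition (RotCompl k L f) := by
  refine ⟨?_, L, rot_zero k L f⟩
  intro i j hij
  unfold RotCompl
  split_ifs with h1 h2
  · have := hf.1 (by omega : L - 1 - j ≤ L - 1 - i)
    omega
  · omega
  · omega
  · omega

theorem rot_rot (k L : ℕ) (f : ℕ → ℕ) (hfk : ∀ i, f i ≤ k) (hfL : ∀ i, L ≤ i → f i = 0) :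
    RotCompl k L (RotCompl k L f) = f := by
  funext i
  unfold RotCompl
  by_cases h : i < L
  · rw [if_pos h, if_pos (by omega)]
    have h1 : L - 1 - (L - 1 - i) = i := by omega
    rw [h1]
    have := hfk i
    omega
  · rw [if_neg h, hfL i (by omega)]

/-- Every skew shape carries an LR tableau: fill columns with `1, 2, 3, …`. -/
theorem exists_LR_tab (L : ℕ) (e m : ℕ → ℕ) (he : IsPartition e) (hm : IsPartition m)
    (heL : ∀ i, L ≤ i → e i = 0) : ∃ c T, IsPartition c ∧ IsLR e m c T := by
  classical
  set T : ℕ → ℕ → ℕ := fun i c =>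
    if m i ≤ c ∧ c < e i then ((range (i + 1)).filter (fun p => m p ≤ c)).card else 0 with hT
  have hpos : ∀ i c, m i ≤ c → 0 < ((range (i + 1)).filter (fun p => m p ≤ c)).card := by
    intro i c h
    exact card_pos.2 ⟨i, by simp [h]⟩
  have hsupp : ∀ p : ℕ × ℕ, T p.1 p.2 ≠ 0 ↔ InSkew e m p := by
    rintro ⟨i, c⟩
    unfold InSkew
    simp only [hT]
    split_ifs with h
    · have := hpos i c h.1
      exact ⟨fun _ => h, fun _ => by omega⟩
    · simp [h]
  have hTlt : ∀ i c, T i c ≠ 0 → c < e i := fun i c hc => ((hsupp (i, c)).1 hc).2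
  have hfin := supp_finite L e he heL T hTlt
  have hf : ∀ (w : ℕ) (Q : ℕ × ℕ → Prop), Set.Finite {p : ℕ × ℕ | T p.1 p.2 = w + 1 ∧ Q p} := by
    intro w Q
    refine hfin.subset (fun p hp => ?_)
    have := hp.1
    simp only [Set.mem_ofPred_eq]
    omega
  have hstep : ∀ i c, InSkew e m (i, c) → InSkew e m (i + 1, c) → T (i + 1) c = T i c + 1 := by
    intro i c h1 h2
    have h1' : m i ≤ c ∧ c < e i := h1
    have h2' : m (i + 1) ≤ c ∧ c < e (i + 1) := h2
    simp only [hT, if_pos h1', if_pos h2']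
    rw [range_add_one (n := i + 1), filter_insert, if_pos h2'.1, card_insert_of_notMem]
    simp
  have hup : ∀ i c v, T i c = v + 2 → 0 < i ∧ T (i - 1) c = v + 1 := by
    intro i c v hv
    have h1 : m i ≤ c ∧ c < e i := (hsupp (i, c)).1 (by simp only; omega)
    cases i with
    | zero =>
      exfalso
      simp only [hT, if_pos h1] at hv
      have := card_filter_le (range (0 + 1)) (fun p => m p ≤ c)
      rw [card_range] at this
      omega
    | succ i =>
      refine ⟨by omega, ?_⟩
      simp only [Nat.add_sub_cancel]
      have h2 : m i ≤ c := by
        by_contra hc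
        have h3 : (range (i + 1 + 1)).filter (fun p => m p ≤ c) ⊆ {i + 1} := by
          intro p
          simp only [mem_filter, mem_range, mem_singleton]
          rintro ⟨h4, h5⟩
          by_contra h6
          have := hm.1 (by omega : p ≤ i)
          omega
        have h4 := card_le_card h3
        rw [card_singleton] at h4
        simp only [hT, if_pos h1] at hv
        omega
      have h3 := he.1 (by omega : i ≤ i + 1)
      have := hstep i c ⟨h2, by simp only; omega⟩ h1
      omega
  have hlat : ∀ i j k : ℕ,
    Nat.card {p : ℕ × ℕ // T p.1 p.2 = k + 2 ∧ (p.1 < i ∨ (p.1 = i ∧ j ≤ p.2))} ≤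
      Nat.card {p : ℕ × ℕ // T p.1 p.2 = k + 1 ∧ (p.1 < i ∨ (p.1 = i ∧ j ≤ p.2))} := by
    intro i j k
    haveI : Finite {p : ℕ × ℕ // T p.1 p.2 = k + 1 ∧ (p.1 < i ∨ (p.1 = i ∧ j ≤ p.2))} := hf k _
    apply Nat.card_le_card_of_injective
      (fun p : {p : ℕ × ℕ // T p.1 p.2 = k + 2 ∧ (p.1 < i ∨ (p.1 = i ∧ j ≤ p.2))} =>
        (⟨(p.1.1 - 1, p.1.2), (hup _ _ _ p.2.1).2, by
          have h1 := (hup _ _ _ p.2.1).1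
          have h2 := p.2.2
          simp only
          omega⟩ : {p : ℕ × ℕ // T p.1 p.2 = k + 1 ∧ (p.1 < i ∨ (p.1 = i ∧ j ≤ p.2))}))
    rintro ⟨⟨a, b⟩, hab, hab2⟩ ⟨⟨a', b'⟩, hab', hab2'⟩ heq
    have h1 := (hup _ _ _ hab).1
    have h2 := (hup _ _ _ hab').1
    simp only [Subtype.mk.injEq, Prod.mk.injEq] at heq h1 h2 ⊢
    omega
  have hall : ∀ v, Nat.card {p : ℕ × ℕ // T p.1 p.2 = v + 1} =
      Nat.card {p : ℕ × ℕ // T p.1 p.2 = v + 1 ∧ (p.1 < L ∨ (p.1 = L ∧ 0 ≤ p.2))} := by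
    intro v
    apply Nat.card_congr
    apply Equiv.subtypeEquivRight
    rintro ⟨a, b⟩
    simp only
    constructor
    · intro hv
      refine ⟨hv, Or.inl ?_⟩
      have := hTlt a b (by omega)
      by_contra hc
      have := heL a (by omega)
      omega
    · exact fun hv => hv.1
  have hLR : IsLR e m (fun v => Nat.card {p : ℕ × ℕ // T p.1 p.2 = v + 1}) T := by
    refine ⟨hsupp, ?_, ?_, fun _ => rfl, hlat⟩
    · intro i c h1 h2
      have h1' : m i ≤ c ∧ c < e i := h1
      have h2' : m i ≤ c + 1 ∧ c + 1 < e i := h2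
      simp only [hT, if_pos h1', if_pos h2']
      apply card_le_card
      intro p
      simp only [mem_filter, mem_range]
      omega
    · intro i c h1 h2
      have := hstep i c h1 h2
      omega
  refine ⟨_, T, ⟨?_, L, ?_⟩, hLR⟩
  · apply antitone_nat_of_succ_le
    intro v
    have := hlat L 0 v
    rw [hall, hall]
    exact this
  · intro v hv
    exact hLR.content_zero he heL v hv

/-- The cover partition of the Schubert product `[m] ⋆_{(k^L)} [n]` (the
componentwise maximum of all `e ⊆ (k^L)` with `c(e; m, n) ≠ 0`) is the
180°-rotated complement in `(k^L)` of the base partition of the skew character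
of `A = (((k^L)/m)°)/n`, whose shape is `RotCompl k L m / n`. -/
theorem stmt11 (k L : ℕ) (m n : ℕ → ℕ) (hm : IsPartition m) (hn : IsPartition n)
    (hmk : ∀ i, m i ≤ k) (hmL : ∀ i, L ≤ i → m i = 0)
    (hnk : ∀ i, n i ≤ k) (hnL : ∀ i, L ≤ i → n i = 0)
    (hsize : (∑ i ∈ Finset.range L, m i) + ∑ i ∈ Finset.range L, n i ≤ k * L)
    (hskew : ∀ i, n i ≤ RotCompl k L m i) :
    ∀ i, i < L →
      sSup {x | ∃ e, IsPartition e ∧ (∀ r, e r ≤ k) ∧ (∀ r, L ≤ r → e r = 0) ∧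
          LR e m n ≠ 0 ∧ e i = x} =
        k - sInf {x | ∃ c, IsPartition c ∧ LR (RotCompl k L m) n c ≠ 0 ∧
          c (L - 1 - i) = x} := by
  intro i hi
  have hRp := rot_part k L m hm
  have hRz := rot_zero k L m
  -- every constituent of the skew character yields a constituent of the Schubert product
  have h21 : ∀ c, IsPartition c → LR (RotCompl k L m) n c ≠ 0 →
      (∀ j, c j ≤ k) ∧ LR (RotCompl k L c) m n ≠ 0 := by
    intro c hc hLR
    obtain ⟨T, hT⟩ := (LR_ne_zero_iff L _ _ _ hRp hRz).1 hLR
    have hck : ∀ j, c j ≤ k := fun j => (hT.content_le hRp hn hRz j).trans (rot_le _ _ _ _)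
    have hcL : ∀ j, L ≤ j → c j = 0 := fun j hj => hT.content_zero hRp hRz j hj
    refine ⟨hck, ?_⟩
    have H1 := hT.hive hRp hn hRz hskew
    have H2 := H1.rot hnk (rot_le k L m)
    rw [rot_rot k L m hmk hmL] at H2
    have H3 := H2.rot hck (rot_le k L n)
    rw [rot_rot k L n hnk hnL] at H3
    exact (LR_ne_zero_iff L _ _ _ (rot_part k L c hc) (rot_zero k L c)).2
      (H3.exists_LR (rot_part k L c hc) hn (rot_zero k L c) hnL)
  have h12 : ∀ e, IsPartition e → (∀ r, e r ≤ k) → (∀ r, L ≤ r → e r = 0) → LR e m n ≠ 0 →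
      ∃ c, IsPartition c ∧ LR (RotCompl k L m) n c ≠ 0 ∧ c (L - 1 - i) ≤ k - e i := by
    intro e he hek heL hLR
    obtain ⟨T, hT⟩ := (LR_ne_zero_iff L _ _ _ he heL).1 hLR
    set e' : ℕ → ℕ := fun r => max (e r) (m r) with he'
    have hsk : ∀ p, InSkew e' m p ↔ InSkew e m p := by
      intro p
      simp only [InSkew, he']
      omega
    have hT' : IsLR e' m n T := by
      refine ⟨fun p => (hT.support p).trans (hsk p).symm, ?_, ?_, hT.content, hT.lattice⟩
      · intro a b h1 h2
        exact hT.row_weak a b ((hsk _).1 h1) ((hsk _).1 h2)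
      · intro a b h1 h2
        exact hT.col_strict a b ((hsk _).1 h1) ((hsk _).1 h2)
    have hp' : IsPartition e' := by
      refine ⟨fun a b hab => max_le_max (he.1 hab) (hm.1 hab), L, fun a ha => ?_⟩
      simp [he', heL a ha, hmL a ha]
    have hL' : ∀ r, L ≤ r → e' r = 0 := fun a ha => by simp [he', heL a ha, hmL a ha]
    have hk' : ∀ r, e' r ≤ k := fun r => max_le (hek r) (hmk r)
    have H1 := hT'.hive hp' hm hL' (fun r => le_max_right _ _)
    have H2 := H1.rot hmk hk'
    refine ⟨RotCompl k L e', rot_part k L e' hp', (LR_ne_zero_iff L _ _ _ hRp hRz).2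
      (H2.exists_LR hRp (rot_part k L e' hp') hRz (rot_zero k L e')), ?_⟩
    have h1 : L - 1 - (L - 1 - i) = i := by omega
    have h2 : e i ≤ e' i := le_max_left _ _
    simp only [RotCompl, if_pos (by omega : L - 1 - i < L), h1]
    omega
  obtain ⟨c0, T0, hc0, hT0⟩ := exists_LR_tab L _ n hRp hn hRz
  have hne : {x | ∃ c, IsPartition c ∧ LR (RotCompl k L m) n c ≠ 0 ∧
      c (L - 1 - i) = x}.Nonempty :=
    ⟨_, c0, hc0, (LR_ne_zero_iff L _ _ _ hRp hRz).2 ⟨T0, hT0⟩, rfl⟩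
  apply IsGreatest.csSup_eq
  constructor
  · obtain ⟨c, hc, hLR, hx⟩ := Nat.sInf_mem hne
    obtain ⟨hck, hLR'⟩ := h21 c hc hLR
    refine ⟨RotCompl k L c, rot_part k L c hc, rot_le k L c, rot_zero k L c, hLR', ?_⟩
    rw [← hx]
    simp only [RotCompl, if_pos hi]
  · rintro x ⟨e, he, hek, heL, hLR, rfl⟩
    obtain ⟨c, hc, hLR', hle⟩ := h12 e he hek heL hLR
    have h1 := Nat.sInf_le (s := {x | ∃ c, IsPartition c ∧ LR (RotCompl k L m) n c ≠ 0 ∧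
      c (L - 1 - i) = x}) ⟨c, hc, hLR', rfl⟩
    have h2 := hek i
    omega
end
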